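/- Consider a matching market in which all firms' choice functions are path-independent and cardinal monotone and all workers' choice functions are path-independent and quota-filling (worker w having quota q_w). If, for a worker w, some stable matching μ satisfies |μ(w)| < q_w, then every two stable matchings assign w the same set of firms, i.e., μ1(w) = μ2(w) for all stable μ1, μ2. -/

import Mathlib

/-- A matching market: finite disjoint sets of firms `F` and workers `W`; each firm `f`
has a set `accF f ⊆ W` of acceptable workers and a choice function `Cf f` on subsets of
`accF f`; each worker `w` has a set `accW w ⊆ F` and a choice function `Cw w`, where
`f ∈ accW w ↔ w ∈ accF f`. -/
structure Market (F W : Type*) [Fintype F] [Fintype W] [DecidableEq F] [DecidableEq W] where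
  accF : F → Finset W
  accW : W → Finset F
  compat : ∀ f w, f ∈ accW w ↔ w ∈ accF f
  Cf : F → Finset W → Finset W
  Cw : W → Finset F → Finset F
  CfSub : ∀ f S, Cf f S ⊆ S
  CwSub : ∀ w S, Cw w S ⊆ S

namespace Market

variable {F W : Type*} [Fintype F] [Fintype W] [DecidableEq F] [DecidableEq W]

/-- The set `μ(w)` of firms matched to worker `w` under the matching `μ`. -/
def mw (M : Market F W) (μ : F → Finset W) (w : W) : Finset F :=
  Finset.univ.filter (fun f => w ∈ μ f)

/-- `μ` is a matching: each firm is matched to acceptable workers. -/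
def IsMatching (M : Market F W) (μ : F → Finset W) : Prop :=
  ∀ f, μ f ⊆ M.accF f

/-- `μ` is individually rational. -/
def IndRational (M : Market F W) (μ : F → Finset W) : Prop :=
  (∀ f, M.Cf f (μ f) = μ f) ∧ (∀ w, M.Cw w (M.mw μ w) = M.mw μ w)

/-- The acceptable pair `(f, w)` blocks `μ`. -/
def Blocks (M : Market F W) (μ : F → Finset W) (f : F) (w : W) : Prop :=
  w ∈ M.accF f ∧ w ∉ μ f ∧
    w ∈ M.Cf f (insert w (μ f)) ∧ f ∈ M.Cw w (insert f (M.mw μ w))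

/-- `μ` is a stable matching. -/
def Stable (M : Market F W) (μ : F → Finset W) : Prop :=
  M.IsMatching μ ∧ M.IndRational μ ∧ ∀ f w, ¬ M.Blocks μ f w

/-- `Dom M μ2 μ1` is the partial order `μ2 ⪰ μ1` on stable matchings:
`C_f(μ2(f) ∪ μ1(f)) = μ2(f)` for every firm `f`. -/
def Dom (M : Market F W) (μ2 μ1 : F → Finset W) : Prop :=
  ∀ f, M.Cf f (μ2 f ∪ μ1 f) = μ2 f

/-- `φ(f)`: the set of stable partners of firm `f`. -/
def phi (M : Market F W) (f : F) : Set W :=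
  {w | ∃ μ, M.Stable μ ∧ w ∈ μ f}

/-- `P_f(μ) = {w ∈ φ(f) : w ∈ C_f(μ(f) ∪ {w})}`. -/
def Pf (M : Market F W) (μ : F → Finset W) (f : F) : Set W :=
  {w | w ∈ M.phi f ∧ w ∈ M.Cf f (insert w (μ f))}

/-- The P-set `P(μ) = {(f, w) : f ∈ F, w ∈ P_f(μ)}`. -/
def Pset (M : Market F W) (μ : F → Finset W) : Set (F × W) :=
  {p | p.2 ∈ M.Pf μ p.1}

/-- All choice functions of the market are path-independent and cardinal monotone
(on their domains). -/
def PathIndepCM (M : Market F W) : Prop :=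
  (∀ f, ∀ S ⊆ M.accF f, ∀ T ⊆ M.accF f, M.Cf f (S ∪ T) = M.Cf f (M.Cf f S ∪ T)) ∧
  (∀ f, ∀ S T : Finset W, S ⊆ T → T ⊆ M.accF f → (M.Cf f S).card ≤ (M.Cf f T).card) ∧
  (∀ w, ∀ S ⊆ M.accW w, ∀ T ⊆ M.accW w, M.Cw w (S ∪ T) = M.Cw w (M.Cw w S ∪ T)) ∧
  (∀ w, ∀ S T : Finset F, S ⊆ T → T ⊆ M.accW w → (M.Cw w S).card ≤ (M.Cw w T).card)

end Market

open Finset in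
/-- A path-independent choice function is substitutable. -/
theorem mem_choice_of_subset {α : Type*} [DecidableEq α] {C : Finset α → Finset α}
    {D : Finset α} (hsub : ∀ S, C S ⊆ S)
    (hpi : ∀ S ⊆ D, ∀ T ⊆ D, C (S ∪ T) = C (C S ∪ T))
    {A B : Finset α} (hAB : A ⊆ B) (hB : B ⊆ D) {x : α} (hxA : x ∈ A) (hx : x ∈ C B) :
    x ∈ C A := by
  have h := hpi A (hAB.trans hB) (B \ A) (sdiff_subset.trans hB)
  rw [union_sdiff_of_subset hAB] at h
  have hx' := hsub _ (h ▸ hx)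
  simpa [hxA] using hx'

open Finset in
theorem sum_card_eq_card_filter_fst {F W : Type*} [Fintype F] [Fintype W] [DecidableEq W]
    (A : F → Finset W) :
    ∑ f, (A f).card = (univ.filter fun p : F × W => p.2 ∈ A p.1).card := by
  rw [card_filter, Fintype.sum_prod_type]
  simp

open Finset in
theorem sum_card_eq_card_filter_snd {F W : Type*} [Fintype F] [Fintype W] [DecidableEq F]
    (A : W → Finset F) :
    ∑ w, (A w).card = (univ.filter fun p : F × W => p.1 ∈ A p.2).card := by
  rw [card_filter, Fintype.sum_prod_type_right]
  simp

namespace Market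

variable {F W : Type*} [Fintype F] [Fintype W] [DecidableEq F] [DecidableEq W]

theorem mem_mw {M : Market F W} {μ : F → Finset W} {f : F} {w : W} :
    f ∈ M.mw μ w ↔ w ∈ μ f := by
  simp [mw]

theorem IsMatching.mw_subset {M : Market F W} {μ : F → Finset W} (h : M.IsMatching μ) (w : W) :
    M.mw μ w ⊆ M.accW w := fun f hf =>
  (M.compat f w).2 (h f (mem_mw.1 hf))

/-- A pair chosen by both sides out of the union of `μ` and `ν` belongs to `μ`, if `μ` is
stable. -/
theorem Stable.mem_of_mem_choice_union {M : Market F W}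
    (hpiF : ∀ f, ∀ S ⊆ M.accF f, ∀ T ⊆ M.accF f,
      M.Cf f (S ∪ T) = M.Cf f (M.Cf f S ∪ T))
    (hpiW : ∀ w, ∀ S ⊆ M.accW w, ∀ T ⊆ M.accW w,
      M.Cw w (S ∪ T) = M.Cw w (M.Cw w S ∪ T))
    {μ ν : F → Finset W} (hμ : M.Stable μ) (hν : M.IsMatching ν) {f : F} {w : W}
    (hf : w ∈ M.Cf f (μ f ∪ ν f)) (hw : f ∈ M.Cw w (M.mw μ w ∪ M.mw ν w)) :
    w ∈ μ f := by
  by_contra hn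
  have hF : μ f ∪ ν f ⊆ M.accF f := Finset.union_subset (hμ.1 f) (hν f)
  have hW : M.mw μ w ∪ M.mw ν w ⊆ M.accW w :=
    Finset.union_subset (hμ.1.mw_subset w) (hν.mw_subset w)
  have hf' := M.CfSub f _ hf
  have hw' := M.CwSub w _ hw
  exact hμ.2.2 f w ⟨hF hf', hn,
    mem_choice_of_subset (M.CfSub f) (hpiF f)
      (Finset.insert_subset hf' Finset.subset_union_left) hF (Finset.mem_insert_self _ _) hf,
    mem_choice_of_subset (M.CwSub w) (hpiW w)
      (Finset.insert_subset hw' Finset.subset_union_left) hW (Finset.mem_insert_self _ _) hw⟩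

/-- A worker chooses, out of the union of two stable matchings, as many firms as are assigned
to them in either one. -/
theorem Stable.card_choice_union {M : Market F W}
    (hpiF : ∀ f, ∀ S ⊆ M.accF f, ∀ T ⊆ M.accF f,
      M.Cf f (S ∪ T) = M.Cf f (M.Cf f S ∪ T))
    (hcmF : ∀ f, ∀ S T : Finset W, S ⊆ T → T ⊆ M.accF f →
      (M.Cf f S).card ≤ (M.Cf f T).card)
    (hpiW : ∀ w, ∀ S ⊆ M.accW w, ∀ T ⊆ M.accW w,
      M.Cw w (S ∪ T) = M.Cw w (M.Cw w S ∪ T))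
    (hcmW : ∀ w, ∀ S T : Finset F, S ⊆ T → T ⊆ M.accW w →
      (M.Cw w S).card ≤ (M.Cw w T).card)
    {μ ν : F → Finset W} (hμ : M.Stable μ) (hν : M.Stable ν) (w : W) :
    (M.Cw w (M.mw μ w ∪ M.mw ν w)).card = (M.mw μ w).card := by
  have hF : ∑ f, (ν f).card ≤ ∑ f, (M.Cf f (μ f ∪ ν f)).card := by
    refine Finset.sum_le_sum fun f _ => ?_
    have h := hcmF f (ν f) (μ f ∪ ν f) Finset.subset_union_right
      (Finset.union_subset (hμ.1 f) (hν.1 f))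
    rwa [hν.2.1.1 f] at h
  have hW : ∀ v ∈ Finset.univ,
      (M.mw μ v).card ≤ (M.Cw v (M.mw μ v ∪ M.mw ν v)).card := fun v _ => by
    have h := hcmW v (M.mw μ v) (M.mw μ v ∪ M.mw ν v) Finset.subset_union_left
      (Finset.union_subset (hμ.1.mw_subset v) (hν.1.mw_subset v))
    rwa [hμ.2.1.2 v] at h
  refine ((Finset.sum_eq_sum_iff_of_le hW).1
    (le_antisymm (Finset.sum_le_sum hW) ?_) w (Finset.mem_univ w)).symm
  rw [sum_card_eq_card_filter_fst, sum_card_eq_card_filter_fst] at hF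
  rw [sum_card_eq_card_filter_snd, sum_card_eq_card_filter_snd]
  simp only [mem_mw]
  set J := Finset.univ.filter fun p : F × W => p.2 ∈ M.Cf p.1 (μ p.1 ∪ ν p.1)
  set K := Finset.univ.filter fun p : F × W => p.1 ∈ M.Cw p.2 (M.mw μ p.2 ∪ M.mw ν p.2)
  set A := Finset.univ.filter fun p : F × W => p.2 ∈ μ p.1
  set B := Finset.univ.filter fun p : F × W => p.2 ∈ ν p.1
  have hunion : J ∪ K ⊆ A ∪ B := by
    intro p hp
    simp only [J, K, A, B, Finset.mem_union, Finset.mem_filter, Finset.mem_univ,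
      true_and] at hp ⊢
    rcases hp with hp | hp
    · simpa using M.CfSub _ _ hp
    · simpa [mem_mw] using M.CwSub _ _ hp
  have hinter : J ∩ K ⊆ A ∩ B := by
    intro p hp
    simp only [J, K, A, B, Finset.mem_inter, Finset.mem_filter, Finset.mem_univ,
      true_and] at hp ⊢
    refine ⟨hμ.mem_of_mem_choice_union hpiF hpiW hν.1 hp.1 hp.2,
      hν.mem_of_mem_choice_union hpiF hpiW hμ.1 ?_ ?_⟩
    · rw [Finset.union_comm]; exact hp.1
    · rw [Finset.union_comm]; exact hp.2
  have h₁ := Finset.card_le_card hunion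
  have h₂ := Finset.card_le_card hinter
  have h₃ := Finset.card_union_add_card_inter J K
  have h₄ := Finset.card_union_add_card_inter A B
  omega

end Market

/-- Consider a matching market in which all firms' choice functions
are path-independent and cardinal monotone and all workers' choice functions are
path-independent and quota-filling (worker `w` having quota `q w`). If for a worker `w`
some stable matching `μ` satisfies `|μ(w)| < q w`, then every two stable matchings
assign `w` the same set of firms. -/
theorem stmt_17 {F W : Type*} [Fintype F] [Fintype W] [DecidableEq F] [DecidableEq W]
    (M : Market F W)
    (hpiF : ∀ f, ∀ S ⊆ M.accF f, ∀ T ⊆ M.accF f,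
      M.Cf f (S ∪ T) = M.Cf f (M.Cf f S ∪ T))
    (hcmF : ∀ f, ∀ S T : Finset W, S ⊆ T → T ⊆ M.accF f →
      (M.Cf f S).card ≤ (M.Cf f T).card)
    (hpiW : ∀ w, ∀ S ⊆ M.accW w, ∀ T ⊆ M.accW w,
      M.Cw w (S ∪ T) = M.Cw w (M.Cw w S ∪ T))
    (q : W → ℕ)
    (hqf : ∀ w, ∀ S ⊆ M.accW w, (M.Cw w S).card = min (q w) S.card)
    (w : W) (μ : F → Finset W) (hμ : M.Stable μ) (hlt : (M.mw μ w).card < q w) :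
    ∀ μ1 μ2 : F → Finset W, M.Stable μ1 → M.Stable μ2 → M.mw μ1 w = M.mw μ2 w := by
  have hcmW : ∀ v, ∀ S T : Finset F, S ⊆ T → T ⊆ M.accW v →
      (M.Cw v S).card ≤ (M.Cw v T).card := fun v S T hST hT => by
    rw [hqf v S (hST.trans hT), hqf v T hT]
    exact min_le_min le_rfl (Finset.card_le_card hST)
  have key : ∀ ν, M.Stable ν → M.mw ν w = M.mw μ w := fun ν hν => by
    have hμν := hμ.card_choice_union hpiF hcmF hpiW hcmW hν w
    have hνμ := hν.card_choice_union hpiF hcmF hpiW hcmW hμ w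
    rw [Finset.union_comm] at hνμ
    have hq := hqf w _ (Finset.union_subset (hμ.1.mw_subset w) (hν.1.mw_subset w))
    have hμU := Finset.eq_of_subset_of_card_le
      (Finset.subset_union_left (s₁ := M.mw μ w) (s₂ := M.mw ν w)) (by omega)
    have hνU := Finset.eq_of_subset_of_card_le
      (Finset.subset_union_right (s₁ := M.mw μ w) (s₂ := M.mw ν w)) (by omega)
    exact hνU.trans hμU.symm
  exact fun μ1 μ2 h1 h2 => (key μ1 h1).trans (key μ2 h2).symm
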